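/- arXiv:2202.13396 — 4 statements merged into one kernel-verified Lean document; each statement's English description precedes it below -/
import Mathlib

section
/- Under the Hypothesis, there is a unique group homomorphism φ̂ : P → Aut(T) whose restriction to Q equals φ; it is given by φ̂(vq) = φ(q) for v ∈ V, q ∈ Q, and its kernel is V·ker(φ). -/
/-- Any homomorphism `P → Aut T` whose image contains `Inn T` is trivial on the abelian normal
subgroup `V`, for `T` nonabelian simple. -/
lemma stmt_6_aux {P : Type*} [Group P] (V : Subgroup P) (hV : V.Normal)
    (hVab : ∀ a ∈ V, ∀ b ∈ V, a * b = b * a)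
    {T : Type*} [Group T] [IsSimpleGroup T]
    (hTna : ∃ a b : T, a * b ≠ b * a)
    (f : P →* MulAut T) (hf : ∀ t : T, MulAut.conj t ∈ f.range) :
    ∀ v ∈ V, f v = 1 := by
  obtain ⟨a, b, hab⟩ := hTna
  have hZ : ∀ z : T, (∀ t, z * t = t * z) → z = 1 := by
    intro z hz
    have hzc : z ∈ Subgroup.center T := Subgroup.mem_center_iff.2 fun t => (hz t).symm
    rcases (inferInstance : (Subgroup.center T).Normal).eq_bot_or_eq_top with h | h
    · rw [h] at hzc
      exact Subgroup.mem_bot.1 hzc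
    · exact absurd (Subgroup.mem_center_iff.1 (h ▸ Subgroup.mem_top b) a) hab
  have hinj : Function.Injective (MulAut.conj : T →* MulAut T) := by
    rw [injective_iff_map_eq_one]
    intro z hz
    refine hZ z fun t => ?_
    have := DFunLike.congr_fun hz t
    simp only [MulAut.conj_apply, MulAut.one_apply] at this
    exact mul_inv_eq_iff_eq_mul.1 this
  -- the elements of `T` inducing an inner automorphism in `f(V)`
  let N : Subgroup T := (V.map f).comap MulAut.conj
  have hmem : ∀ t : T, t ∈ N ↔ ∃ v ∈ V, f v = MulAut.conj t := fun t => Iff.rfl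
  have hN : N.Normal := by
    constructor
    intro n hn g
    obtain ⟨v, hv, hvn⟩ := (hmem n).1 hn
    obtain ⟨x, hx⟩ := hf g
    refine (hmem _).2 ⟨x * v * x⁻¹, hV.conj_mem v hv x, ?_⟩
    rw [map_mul, map_mul, map_inv, hvn, hx, map_mul, map_mul, map_inv]
  have hNbot : N = ⊥ := by
    rcases hN.eq_bot_or_eq_top with h | h
    · exact h
    · exfalso
      obtain ⟨v, hv, hva⟩ := (hmem a).1 (h ▸ Subgroup.mem_top a)
      obtain ⟨w, hw, hwb⟩ := (hmem b).1 (h ▸ Subgroup.mem_top b)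
      apply hab
      apply hinj
      rw [map_mul, map_mul, ← hva, ← hwb, ← map_mul, ← map_mul, hVab v hv w hw]
  intro v hv
  ext t
  obtain ⟨x, hx⟩ := hf t
  have key : f v t * t⁻¹ ∈ N := by
    refine (hmem _).2 ⟨v * (x * v⁻¹ * x⁻¹),
      V.mul_mem hv (hV.conj_mem _ (V.inv_mem hv) x), ?_⟩
    rw [map_mul, map_mul, map_mul, map_inv, map_inv, hx]
    ext s
    simp [MulAut.mul_apply, MulAut.conj_apply, mul_assoc]
  rw [hNbot, Subgroup.mem_bot, mul_inv_eq_one] at key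
  simpa using key

/-- Under the Hypothesis, there is a unique group homomorphism `φ̂ : P → Aut T` whose
restriction to `Q` equals `φ`; it is given by `φ̂(vq) = φ(q)` for `v ∈ V`, `q ∈ Q`,
and its kernel is `V·ker(φ)`. -/
theorem stmt_6
    -- The Hypothesis --
    (p : ℕ) (hp : p.Prime)
    {P : Type*} [Group P] [Fintype P]
    -- `V` and `Q` are identified with subgroups of `P = V ⋊ Q`:
    (V Q : Subgroup P) (hVnorm : V.Normal)
    -- every element of `P` is uniquely a product `v * q` with `v ∈ V`, `q ∈ Q`:
    (hcompl : Subgroup.IsComplement' V Q)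
    -- `V` is a (finite) vector space over `𝔽_p`, i.e. elementary abelian of exponent `p`:
    (hVab : ∀ a ∈ V, ∀ b ∈ V, a * b = b * a) (hVp : ∀ a ∈ V, a ^ p = 1)
    -- of order `k = |V| ≥ 2`:
    (hVcard : 2 ≤ Nat.card V)
    -- the (conjugation) action of `Q` on `V` is faithful:
    (hfaith : ∀ q ∈ Q, (∀ v ∈ V, q * v * q⁻¹ = v) → q = 1)
    -- and transitive on the nonzero vectors of `V`:
    (htrans : ∀ v ∈ V, ∀ w ∈ V, v ≠ 1 → w ≠ 1 → ∃ q ∈ Q, q * v * q⁻¹ = w)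
    -- `T` is a finite nonabelian simple group:
    {T : Type*} [Group T] [Finite T] [IsSimpleGroup T]
    (hTna : ∃ a b : T, a * b ≠ b * a)
    -- and `φ : Q → Aut T` is a homomorphism whose image contains `Inn T`:
    (φ : Q →* MulAut T) (hφ : ∀ t : T, MulAut.conj t ∈ φ.range)
    :
    (∃! φhat : P →* MulAut T, ∀ q : Q, φhat ↑q = φ q) ∧
    (∀ φhat : P →* MulAut T, (∀ q : Q, φhat ↑q = φ q) →
      ((∀ v ∈ V, ∀ q : Q, φhat (v * ↑q) = φ q) ∧
        φhat.ker = V ⊔ Subgroup.map Q.subtype φ.ker)) := by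
  have hdec : ∀ x : P, ∃ v ∈ V, ∃ q : Q, x = v * q := by
    intro x
    obtain ⟨⟨v, q⟩, h⟩ := hcompl.2 x
    exact ⟨v, v.2, q, h.symm⟩
  have htriv : ∀ f : P →* MulAut T, (∀ q : Q, f ↑q = φ q) → ∀ v ∈ V, f v = 1 := by
    intro f hf
    refine stmt_6_aux V hVnorm hVab hTna f fun t => ?_
    obtain ⟨q, hq⟩ := hφ t
    exact ⟨q, (hf q).trans hq⟩
  have hform : ∀ f : P →* MulAut T, (∀ q : Q, f ↑q = φ q) →
      ∀ v ∈ V, ∀ q : Q, f (v * ↑q) = φ q := by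
    intro f hf v hv q
    rw [map_mul, htriv f hf v hv, one_mul, hf]
  refine ⟨?_, fun f hf => ⟨hform f hf, ?_⟩⟩
  · let e : P ⧸ V ≃* Q := hcompl.symm.QuotientMulEquiv
    refine ⟨φ.comp (e.toMonoidHom.comp (QuotientGroup.mk' V)), ?_, ?_⟩
    · intro q
      have he : e (QuotientGroup.mk' V (q : P)) = q := by
        rw [← MulEquiv.eq_symm_apply]
        rfl
      exact congrArg φ he
    · intro g hg
      ext1 x
      obtain ⟨v, hv, q, rfl⟩ := hdec x
      rw [hform g hg v hv q]
      symm
      refine hform _ ?_ v hv q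
      intro q
      have he : e (QuotientGroup.mk' V (q : P)) = q := by
        rw [← MulEquiv.eq_symm_apply]
        rfl
      exact congrArg φ he
  · apply le_antisymm
    · intro x hx
      obtain ⟨v, hv, q, rfl⟩ := hdec x
      rw [MonoidHom.mem_ker, hform f hf v hv q] at hx
      exact Subgroup.mul_mem_sup hv ⟨q, hx, rfl⟩
    · refine sup_le (fun v hv => htriv f hf v hv) ?_
      rintro _ ⟨q, hq, rfl⟩
      exact (hf q).trans hq
end

section
/- Under the Hypothesis, with φ̂ : P → Aut(T) defined by φ̂(vq) = φ(q), and f_t : P → T defined by f_t(h) = φ̂(h)(t) for t ∈ T: (i) each f_t belongs to N and the map t ↦ f_t is an injective group homomorphism T → N; (ii) an element f ∈ N satisfies f(rh) = f(h) for all r ∈ V·ker(φ) and all h ∈ P if and only if f = f_t for some t ∈ T. In other words, the set of elements of N centralized by the action of V·ker(φ) is exactly N̂ = { f_t : t ∈ T } ≅ T. -/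
/-!  The base group `N` of the twisted wreath product `T twr_φ P`, and the action of
`P` on it.  (The paper lets automorphisms and groups act on the right; in Lean,
automorphisms are applied on the left, so the construction is mirrored left-to-right:
`N` consists of the functions `f : P → T` with `f (q * h) = φ q (f h)`, and `g ∈ P`
acts on `N` by `(g • f) (h) = f (h * g)`.) -/

/-- The base group `N = { f : P → T | f(qh) = φ(q)(f(h)) for all h ∈ P, q ∈ Q }` of a
twisted wreath product, a subgroup of the direct product `∏_P T` with pointwise
multiplication. -/
def twN {P T : Type*} [Group P] [Group T] (Q : Subgroup P) (φ : Q →* MulAut T) :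
    Subgroup (P → T) where
  carrier := {f | ∀ (h : P) (q : Q), f (↑q * h) = φ q (f h)}
  one_mem' := by intro h q; simp
  mul_mem' := by
    intro f g hf hg h q
    simp only [Pi.mul_apply, hf h q, hg h q, map_mul]
  inv_mem' := by
    intro f hf h q
    simp only [Pi.inv_apply, hf h q, map_inv]

theorem mem_twN_iff {P T : Type*} [Group P] [Group T] (Q : Subgroup P)
    (φ : Q →* MulAut T) (f : P → T) :
    f ∈ twN Q φ ↔ ∀ (h : P) (q : Q), f (↑q * h) = φ q (f h) := Iff.rfl

/-- The (translation) action of `P` on the base group `N` of the twisted wreath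
product, `(g • f) (h) = f (h * g)`. -/
def twAct {P T : Type*} [Group P] [Group T] (Q : Subgroup P) (φ : Q →* MulAut T) :
    P →* MulAut (twN Q φ) where
  toFun g :=
    { toFun := fun f => ⟨fun h => (f : P → T) (h * g), by
        intro h q
        simpa [mul_assoc] using f.2 (h * g) q⟩
      invFun := fun f => ⟨fun h => (f : P → T) (h * g⁻¹), by
        intro h q
        simpa [mul_assoc] using f.2 (h * g⁻¹) q⟩
      left_inv := fun f => Subtype.ext (funext fun h => by simp)
      right_inv := fun f => Subtype.ext (funext fun h => by simp)
      map_mul' := fun f₁ f₂ => rfl }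
  map_one' := by
    ext f
    exact congrFun (congrArg Subtype.val (Subtype.ext (funext fun h => by simp))) _
  map_mul' := fun g₁ g₂ => by
    ext f
    exact congrFun (congrArg Subtype.val (Subtype.ext (funext fun h => by
      simp [mul_assoc]))) _

/-- Any extension of `φ` to `P` is automatically trivial on the abelian normal
subgroup `V`, because the image of `φ` contains `Inn T`. -/
theorem hat_trivial_on_V {P : Type*} [Group P] (V Q : Subgroup P) (hVnorm : V.Normal)
    (hVab : ∀ a ∈ V, ∀ b ∈ V, a * b = b * a)
    {T : Type*} [Group T] [IsSimpleGroup T]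
    (hTna : ∃ a b : T, a * b ≠ b * a)
    (φ : Q →* MulAut T) (hφ : ∀ t : T, MulAut.conj t ∈ φ.range)
    (φhat : P →* MulAut T) (hext : ∀ q : Q, φhat ↑q = φ q) :
    ∀ v ∈ V, φhat v = 1 := by
  obtain ⟨a, b, hab⟩ := hTna
  -- `T` has trivial centre
  have hinj : ∀ x y : T, MulAut.conj x = MulAut.conj y → x = y := by
    have hker : (MulAut.conj : T →* MulAut T).ker = ⊥ := by
      rcases (MonoidHom.normal_ker (MulAut.conj : T →* MulAut T)).eq_bot_or_eq_top with h | h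
      · exact h
      · exfalso
        have ha : a ∈ (MulAut.conj : T →* MulAut T).ker := h ▸ Subgroup.mem_top a
        have h2 := DFunLike.congr_fun (MonoidHom.mem_ker.1 ha) b
        simp only [MulAut.conj_apply, MulAut.one_apply] at h2
        exact hab (mul_inv_eq_iff_eq_mul.1 h2)
    exact fun x y h => (MonoidHom.ker_eq_bot_iff _).1 hker h
  -- lifts of inner automorphisms
  have hlift : ∀ t : T, ∃ g : P, φhat g = MulAut.conj t := by
    intro t
    obtain ⟨q, hq⟩ := hφ t
    exact ⟨q, (hext q).trans hq⟩
  -- the preimage of `φ̂(V)` in `T`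
  let S : Subgroup T := (V.map φhat).comap MulAut.conj
  have hSn : S.Normal := by
    refine ⟨fun s hs t => ?_⟩
    obtain ⟨v, hv, hvs⟩ := hs
    obtain ⟨g, hg⟩ := hlift t
    exact ⟨g * v * g⁻¹, hVnorm.conj_mem v hv g, by simp only [map_mul, map_inv, hg, hvs]⟩
  have hS : S = ⊥ := by
    rcases hSn.eq_bot_or_eq_top with h | h
    · exact h
    · exfalso
      have ha : a ∈ S := h ▸ Subgroup.mem_top a
      have hb : b ∈ S := h ▸ Subgroup.mem_top b
      obtain ⟨v, hv, hva⟩ := ha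
      obtain ⟨w, hw, hwb⟩ := hb
      apply hab
      apply hinj
      rw [map_mul, map_mul, ← hva, ← hwb, ← map_mul, ← map_mul, hVab v hv w hw]
  intro v hv
  ext t
  obtain ⟨g, hg⟩ := hlift t
  have hm : t * (φhat v t)⁻¹ ∈ S := by
    refine ⟨g * v * g⁻¹ * v⁻¹, V.mul_mem (hVnorm.conj_mem v hv g) (V.inv_mem hv), ?_⟩
    simp only [map_mul, map_inv, hg]
    ext x
    simp [MulAut.mul_apply, mul_assoc]
  rw [hS, Subgroup.mem_bot, mul_inv_eq_one] at hm
  simpa using hm.symm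

/-- Under the Hypothesis, with `φ̂ : P → Aut T` the homomorphism extending `φ` and
`f_t : P → T` defined by `f_t(h) = φ̂(h)(t)`:
(i) each `f_t` belongs to `N` and `t ↦ f_t` is an injective group homomorphism
`T → N`; (ii) an element `f ∈ N` is centralized by the action of `V·ker(φ)`
(i.e. `f(hr) = f(h)` for all `r ∈ V·ker(φ)`, `h ∈ P`) if and only if `f = f_t` for
some `t ∈ T`.  So the fixed points of `V·ker(φ)` on `N` form the subgroup
`N̂ = { f_t : t ∈ T } ≅ T`. -/
theorem stmt_8
    -- The Hypothesis --
    (p : ℕ) (hp : p.Prime)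
    {P : Type*} [Group P] [Fintype P]
    -- `V` and `Q` are identified with subgroups of `P = V ⋊ Q`:
    (V Q : Subgroup P) (hVnorm : V.Normal)
    -- every element of `P` is uniquely a product `v * q` with `v ∈ V`, `q ∈ Q`:
    (hcompl : Subgroup.IsComplement' V Q)
    -- `V` is a (finite) vector space over `𝔽_p`, i.e. elementary abelian of exponent `p`:
    (hVab : ∀ a ∈ V, ∀ b ∈ V, a * b = b * a) (hVp : ∀ a ∈ V, a ^ p = 1)
    -- of order `k = |V| ≥ 2`:
    (hVcard : 2 ≤ Nat.card V)
    -- the (conjugation) action of `Q` on `V` is faithful: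
    (hfaith : ∀ q ∈ Q, (∀ v ∈ V, q * v * q⁻¹ = v) → q = 1)
    -- and transitive on the nonzero vectors of `V`:
    (htrans : ∀ v ∈ V, ∀ w ∈ V, v ≠ 1 → w ≠ 1 → ∃ q ∈ Q, q * v * q⁻¹ = w)
    -- `T` is a finite nonabelian simple group:
    {T : Type*} [Group T] [Finite T] [IsSimpleGroup T]
    (hTna : ∃ a b : T, a * b ≠ b * a)
    -- and `φ : Q → Aut T` is a homomorphism whose image contains `Inn T`:
    (φ : Q →* MulAut T) (hφ : ∀ t : T, MulAut.conj t ∈ φ.range)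
    -- `φ̂`, the homomorphism `P → Aut T` restricting to `φ` on `Q`:
    (φhat : P →* MulAut T) (hext : ∀ q : Q, φhat ↑q = φ q) :
    -- (i) each `f_t : h ↦ φ̂(h)(t)` lies in `N` ...
    (∀ t : T, (fun h : P => φhat h t) ∈ twN Q φ) ∧
    -- ... and `t ↦ f_t` is an injective group homomorphism `T → N`;
    (∃ j : T →* twN Q φ, Function.Injective j ∧
        ∀ (t : T) (h : P), (j t : P → T) h = φhat h t) ∧
    -- (ii) `f ∈ N` is centralized by the action of `V·ker(φ)` iff `f = f_t` for some `t`.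
    (∀ f : twN Q φ,
        (∀ r ∈ V ⊔ Subgroup.map Q.subtype φ.ker, ∀ h : P,
            (f : P → T) (h * r) = (f : P → T) h) ↔
          ∃ t : T, ∀ h : P, (f : P → T) h = φhat h t) := by
  have hV1 : ∀ v ∈ V, φhat v = 1 :=
    hat_trivial_on_V V Q hVnorm hVab hTna φ hφ φhat hext
  have hmem : ∀ t : T, (fun h : P => φhat h t) ∈ twN Q φ := by
    intro t h q
    simp only [map_mul, hext, MulAut.mul_apply]
  refine ⟨hmem, ⟨⟨⟨fun t => ⟨_, hmem t⟩, ?_⟩, ?_⟩, ?_, fun t h => rfl⟩, ?_⟩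
  · exact Subtype.ext (funext fun h => by simp)
  · intro a b
    exact Subtype.ext (funext fun h => by simp)
  · intro a b hab
    have := congrFun (congrArg Subtype.val hab) 1
    simpa using this
  · intro f
    constructor
    · intro hf
      refine ⟨(f : P → T) 1, fun h => ?_⟩
      have hh : h ∈ (Q ⊔ V : Subgroup P) := by
        rw [sup_comm, hcompl.sup_eq_top]; trivial
      obtain ⟨q, hq, v, hv, rfl⟩ := Subgroup.mem_sup_of_normal_right.1 hh
      have h1 := f.2 1 ⟨q, hq⟩
      rw [hf v (Subgroup.mem_sup_left hv), map_mul, hV1 v hv, mul_one, hext ⟨q, hq⟩, ← h1]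
      simp
    · rintro ⟨t, ht⟩ r hr h
      have hle : V ⊔ Subgroup.map Q.subtype φ.ker ≤ φhat.ker := by
        refine sup_le (fun v hv => hV1 v hv) ?_
        rintro _ ⟨q, hq, rfl⟩
        exact (hext q).trans hq
      have hr1 : φhat r = 1 := hle hr
      rw [ht, ht, map_mul, hr1, mul_one]
end

section
/- Under the Hypothesis, let G = N ⋊ P be the twisted wreath product T twr_φ P, identifying N and P with subgroups of G. If H is a subgroup of G with P ≤ H ≤ G, then H = P, or H = N̂P (the subgroup generated by N̂ and P), or H = G. Equivalently, N̂P is the unique subgroup strictly between P and G. -/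
theorem tw_bot_or_top {T : Type*} [Group T] [IsSimpleGroup T] (A : Subgroup T)
    (h : ∀ a ∈ A, ∀ t : T, t * a * t⁻¹ ∈ A) : A = ⊥ ∨ A = ⊤ :=
  Subgroup.Normal.eq_bot_or_eq_top (H := A) ⟨h⟩

theorem tw_center {T : Type*} [Group T] [IsSimpleGroup T]
    (hTna : ∃ a b : T, a * b ≠ b * a) (z : T) (hz : ∀ t, t * z = z * t) : z = 1 := by
  rcases tw_bot_or_top (Subgroup.center T) (fun a ha t => by
    rw [Subgroup.mem_center_iff.1 ha t]; simpa using ha) with h | h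
  · have : z ∈ Subgroup.center T := Subgroup.mem_center_iff.2 hz
    rw [h] at this
    simpa using this
  · obtain ⟨a, b, hab⟩ := hTna
    have : b ∈ Subgroup.center T := by rw [h]; trivial
    exact absurd (Subgroup.mem_center_iff.1 this a) hab

theorem tw_conj_inj {T : Type*} [Group T] [IsSimpleGroup T]
    (hTna : ∃ a b : T, a * b ≠ b * a) (x y : T)
    (h : MulAut.conj x = MulAut.conj y) : x = y := by
  have h1 : y⁻¹ * x = 1 := by
    apply tw_center hTna
    intro t
    have := congrArg (fun e : MulAut T => e t) h
    simp only [MulAut.conj_apply] at this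
    have h2 : x * t = y * t * y⁻¹ * x := by rw [← this]; group
    calc t * (y⁻¹ * x) = y⁻¹ * (y * t * y⁻¹ * x) := by group
      _ = y⁻¹ * x * t := by rw [← h2]; group
  exact (inv_mul_eq_one.1 h1).symm

theorem tw_trivial_on_V {P T : Type*} [Group P] [Group T] [IsSimpleGroup T]
    (hTna : ∃ a b : T, a * b ≠ b * a) (V : Subgroup P) (hV : V.Normal)
    (hVab : ∀ a ∈ V, ∀ b ∈ V, a * b = b * a)
    (ψ : P →* MulAut T) (hψ : ∀ t : T, ∃ q : P, ψ q = MulAut.conj t) :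
    ∀ v ∈ V, ψ v = 1 := by
  have key : (V.map ψ).comap MulAut.conj = ⊥ := by
    rcases tw_bot_or_top ((V.map ψ).comap MulAut.conj) (by
      rintro a ⟨v, hv, hva⟩ t
      obtain ⟨q, hq⟩ := hψ t
      refine ⟨q * v * q⁻¹, hV.conj_mem v hv q, ?_⟩
      simp only [map_mul, map_inv, hq, hva]) with h | h
    · exact h
    · exfalso
      obtain ⟨a, b, hab⟩ := hTna
      have ha : a ∈ (V.map ψ).comap MulAut.conj := by rw [h]; trivial
      have hb : b ∈ (V.map ψ).comap MulAut.conj := by rw [h]; trivial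
      obtain ⟨v, hv, hva⟩ := ha
      obtain ⟨w, hw, hwb⟩ := hb
      apply hab
      apply tw_conj_inj ⟨a, b, hab⟩
      rw [map_mul, map_mul, ← hva, ← hwb, ← map_mul, ← map_mul, hVab v hv w hw]
  intro v hv
  ext t
  obtain ⟨q, hq⟩ := hψ t
  have : ψ v t * t⁻¹ ∈ (V.map ψ).comap MulAut.conj := by
    refine ⟨v * (q * v⁻¹ * q⁻¹), V.mul_mem hv (hV.conj_mem _ (V.inv_mem hv) q), ?_⟩
    simp only [map_mul, map_inv, hq]
    ext s
    simp [MulAut.conj_apply]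
  rw [key, Subgroup.mem_bot, mul_inv_eq_one] at this
  simpa using this

/-- A subgroup of `T^ι` which separates pairs of coordinates is everything. -/
theorem tw_full {ι T : Type*} [Finite ι] [Group T] [IsSimpleGroup T]
    (hTna : ∃ a b : T, a * b ≠ b * a) (M : Subgroup (ι → T))
    (hsurj : ∀ i t, ∃ f ∈ M, f i = t)
    (hM : ∀ i j : ι, i ≠ j → ∀ t, ∃ f ∈ M, f i = 1 ∧ f j = t) : M = ⊤ := by
  classical
  cases nonempty_fintype ι
  have h1 : ∀ (j : ι) (S : Finset ι), j ∉ S → ∀ t, ∃ f ∈ M, (∀ i ∈ S, f i = 1) ∧ f j = t := by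
    intro j S
    induction S using Finset.induction_on with
    | empty =>
      intro _ t
      obtain ⟨f, hf, h⟩ := hsurj j t
      exact ⟨f, hf, by simp, h⟩
    | insert u S hu ih =>
      intro hj
      have hju : u ≠ j := by rintro rfl; simp at hj
      have hjS : j ∉ S := fun h => hj (by simp [h])
      let A : Subgroup T :=
        { carrier := {t | ∃ f ∈ M, (∀ i ∈ insert u S, f i = 1) ∧ f j = t}
          one_mem' := ⟨1, M.one_mem, by simp, rfl⟩
          mul_mem' := by
            rintro a b ⟨f, hf, hf1, rfl⟩ ⟨g, hg, hg1, rfl⟩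
            exact ⟨f * g, M.mul_mem hf hg, fun i hi => by simp [hf1 i hi, hg1 i hi], rfl⟩
          inv_mem' := by
            rintro a ⟨f, hf, hf1, rfl⟩
            exact ⟨f⁻¹, M.inv_mem hf, fun i hi => by simp [hf1 i hi], rfl⟩ }
      have hA : A = ⊤ := by
        rcases tw_bot_or_top A (by
          rintro a ⟨f, hf, hf1, rfl⟩ t
          obtain ⟨g, hg, rfl⟩ := hsurj j t
          exact ⟨g * f * g⁻¹, M.mul_mem (M.mul_mem hg hf) (M.inv_mem hg),
            fun i hi => by simp [hf1 i hi], rfl⟩) with h | h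
        · exfalso
          obtain ⟨a, b, hab⟩ := hTna
          obtain ⟨f, hf, hf1, rfl⟩ := ih hjS a
          obtain ⟨g, hg, hg1, rfl⟩ := hM u j hju b
          have : f j * g j * (f j)⁻¹ * (g j)⁻¹ ∈ A := by
            refine ⟨f * g * f⁻¹ * g⁻¹, M.mul_mem (M.mul_mem (M.mul_mem hf hg) (M.inv_mem hf))
              (M.inv_mem hg), ?_, rfl⟩
            intro i hi
            rcases Finset.mem_insert.1 hi with rfl | hi
            · simp [hg1]
            · simp [hf1 i hi]
          rw [h, Subgroup.mem_bot] at this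
          apply hab
          rw [mul_inv_eq_one, mul_inv_eq_iff_eq_mul] at this
          exact this
        · exact h
      intro t
      have : t ∈ A := by rw [hA]; trivial
      exact this
  have h2 : ∀ (S : Finset ι) (f : ι → T), (∀ i ∉ S, f i = 1) → f ∈ M := by
    intro S
    induction S using Finset.induction_on with
    | empty =>
      intro f hf
      have : f = 1 := funext fun i => hf i (by simp)
      rw [this]; exact M.one_mem
    | insert u S hu ih =>
      intro f hf
      obtain ⟨g, hg, hg1, hgu⟩ := h1 u (Finset.univ.erase u) (by simp) (f u)
      have : f * g⁻¹ ∈ M := by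
        apply ih
        intro i hi
        by_cases hiu : i = u
        · subst hiu; simp [hgu]
        · have : f i = 1 := hf i (by simp [hi, hiu])
          simp [this, hg1 i (by simp [hiu])]
      simpa using M.mul_mem this hg
  rw [eq_top_iff]
  intro f _
  exact h2 Finset.univ f (by simp)

theorem tw_invariant {P T : Type*} [Group P] [Finite P] [Group T] [IsSimpleGroup T]
    (V Q : Subgroup P) (hV : V.Normal)
    (hcompl : Subgroup.IsComplement' V Q)
    (hVab : ∀ a ∈ V, ∀ b ∈ V, a * b = b * a)
    (htrans : ∀ v ∈ V, ∀ w ∈ V, v ≠ 1 → w ≠ 1 → ∃ q ∈ Q, q * v * q⁻¹ = w)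
    (hTna : ∃ a b : T, a * b ≠ b * a)
    (φ : Q →* MulAut T) (hφ : ∀ t : T, MulAut.conj t ∈ φ.range)
    (φhat : P →* MulAut T) (hext : ∀ q : Q, φhat ↑q = φ q)
    (M : Subgroup (P → T)) (hMN : M ≤ twN Q φ)
    (hMP : ∀ f ∈ M, ∀ g : P, (fun h => f (h * g)) ∈ M) :
    M = ⊥ ∨ (∀ f, f ∈ M ↔ ∃ t, ∀ h, f h = φhat h t) ∨ M = twN Q φ := by
  have hdec : ∀ h : P, ∃ q : Q, ∃ v ∈ V, h = q * v := by
    intro h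
    obtain ⟨⟨q, v⟩, hqv⟩ := hcompl.symm.2 h
    exact ⟨q, v, v.2, hqv.symm⟩
  have hMq : ∀ f ∈ M, ∀ (q : Q) (h : P), f (q * h) = φ q (f h) := fun f hf q h => hMN hf h q
  have hMq1 : ∀ f ∈ M, ∀ (q : Q), f q = φ q (f 1) := fun f hf q => by
    simpa using hMq f hf q 1
  by_cases hbot : M = ⊥
  · exact Or.inl hbot
  right
  -- subdirect
  have hs1 : ∀ t, ∃ f ∈ M, f 1 = t := by
    have hA : M.map (Pi.evalMonoidHom (fun _ : P => T) 1) = ⊤ := by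
      rcases tw_bot_or_top (M.map (Pi.evalMonoidHom (fun _ : P => T) 1)) (by
        rintro a ⟨f, hf, rfl⟩ t
        obtain ⟨q, hq⟩ := hφ t
        refine ⟨_, hMP f hf q, ?_⟩
        simp only [Pi.evalMonoidHom_apply, one_mul]
        rw [hMq1 f hf q, hq, MulAut.conj_apply]) with h | h
      · exfalso
        apply hbot
        rw [eq_bot_iff]
        intro f hf
        rw [Subgroup.mem_bot]
        funext g
        have : f g ∈ M.map (Pi.evalMonoidHom (fun _ : P => T) 1) :=
          ⟨_, hMP f hf g, by simp⟩
        rw [h] at this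
        simpa using this
      · exact h
    intro t
    have : t ∈ M.map (Pi.evalMonoidHom (fun _ : P => T) 1) := by rw [hA]; trivial
    obtain ⟨f, hf, h⟩ := this
    exact ⟨f, hf, h⟩
  have hs : ∀ (g : P) t, ∃ f ∈ M, f g = t := by
    intro g t
    obtain ⟨f, hf, h⟩ := hs1 t
    exact ⟨_, hMP f hf g⁻¹, by simpa using h⟩
  by_cases hdiag : ∀ f ∈ M, f 1 = 1 → f = 1
  · left
    choose s hsM hs1' using hs1
    have huniq : ∀ f ∈ M, s (f 1) = f := by
      intro f hf
      have := hdiag (s (f 1) * f⁻¹) (M.mul_mem (hsM _) (M.inv_mem hf)) (by simp [hs1'])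
      exact mul_inv_eq_one.1 this
    have hsmul : ∀ a b, s (a * b) = s a * s b := by
      intro a b
      have := huniq (s a * s b) (M.mul_mem (hsM _) (hsM _))
      simpa [hs1'] using this
    have hcomp : ∀ g h t, s (s t h) g = s t (g * h) := by
      intro g h t
      have := huniq _ (hMP (s t) (hsM t) h)
      simp only [one_mul] at this
      rw [this]
    let ψ : P →* MulAut T :=
      { toFun := fun g =>
          { toFun := fun t => s t g
            invFun := fun t => s t g⁻¹
            left_inv := fun t => by simp [hcomp, hs1']
            right_inv := fun t => by simp [hcomp, hs1']
            map_mul' := fun a b => by simp [hsmul] }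
        map_one' := by ext t; simp [hs1']
        map_mul' := fun g h => by ext t; simp [hcomp] }
    have hψt : ∀ v ∈ V, ψ v = 1 := by
      apply tw_trivial_on_V hTna V hV hVab
      intro t
      obtain ⟨q, hq⟩ := hφ t
      refine ⟨q, ?_⟩
      rw [← hq]
      ext x
      change s x q = φ q x
      rw [hMq1 _ (hsM x), hs1']
    have hφt : ∀ v ∈ V, φhat v = 1 := by
      apply tw_trivial_on_V hTna V hV hVab
      intro t
      obtain ⟨q, hq⟩ := hφ t
      exact ⟨q, by rw [hext, hq]⟩
    have hst : ∀ t g, s t g = φhat g t := by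
      intro t g
      obtain ⟨q, v, hv, rfl⟩ := hdec g
      have h1 : s t v = t := by
        have : ψ v t = t := by rw [hψt v hv]; rfl
        exact this
      rw [hMq _ (hsM t), h1, map_mul, hφt v hv, hext, mul_one]
    intro f
    constructor
    · intro hf
      refine ⟨f 1, fun h => ?_⟩
      rw [← hst, huniq f hf]
    · rintro ⟨t, ht⟩
      have : f = s t := funext fun h => by rw [ht, hst]
      rw [this]; exact hsM t
  · right
    push Not at hdiag
    obtain ⟨f, hf, hf1, hfne⟩ := hdiag
    obtain ⟨g, hg⟩ : ∃ g, f g ≠ 1 := by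
      by_contra! h
      exact hfne (funext h)
    obtain ⟨q, v, hv, rfl⟩ := hdec g
    have hfv : f v ≠ 1 := by
      intro h
      rw [hMq f hf, h, map_one] at hg
      exact hg rfl
    have hv1 : v ≠ 1 := by rintro rfl; exact hfv hf1
    have hpair1 : ∀ w ∈ V, w ≠ 1 → ∀ t, ∃ f ∈ M, f 1 = 1 ∧ f w = t := by
      intro w hw hw1
      let A : Subgroup T :=
        { carrier := {t | ∃ f ∈ M, f 1 = 1 ∧ f w = t}
          one_mem' := ⟨1, M.one_mem, rfl, rfl⟩
          mul_mem' := by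
            rintro a b ⟨f, hf, hf1, rfl⟩ ⟨g, hg, hg1, rfl⟩
            exact ⟨f * g, M.mul_mem hf hg, by simp [hf1, hg1], rfl⟩
          inv_mem' := by
            rintro a ⟨f, hf, hf1, rfl⟩
            exact ⟨f⁻¹, M.inv_mem hf, by simp [hf1], rfl⟩ }
      have hA : A = ⊤ := by
        rcases tw_bot_or_top A (by
          rintro a ⟨f, hf, hf1, rfl⟩ t
          obtain ⟨g, hg, rfl⟩ := hs w t
          exact ⟨g * f * g⁻¹, M.mul_mem (M.mul_mem hg hf) (M.inv_mem hg),
            by simp [hf1], rfl⟩) with h | h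
        · exfalso
          obtain ⟨r, hr, hrw⟩ := htrans v hv w hw hv1 hw1
          have hwr : w * r = r * v := by rw [← hrw]; group
          have : φ ⟨r, hr⟩ (f v) ∈ A := by
            refine ⟨_, hMP f hf r, ?_, ?_⟩
            · have := hMq1 f hf ⟨r, hr⟩
              simpa [hf1] using this
            · have := hMq f hf ⟨r, hr⟩ v
              simpa [hwr] using this
          rw [h, Subgroup.mem_bot] at this
          apply hfv
          simpa using this
        · exact h
      intro t
      have : t ∈ A := by rw [hA]; trivial
      exact this
    let res : (P → T) →* (V → T) :=
      { toFun := fun f v => f v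
        map_one' := rfl
        map_mul' := fun _ _ => rfl }
    have htop : M.map res = ⊤ := by
      apply tw_full hTna
      · intro i t
        obtain ⟨f, hf, h⟩ := hs i t
        exact ⟨_, ⟨f, hf, rfl⟩, h⟩
      · intro i j hij t
        obtain ⟨f, hf, h1, h2⟩ := hpair1 (j * i⁻¹ : V) (j * i⁻¹ : V).2 (by
          intro h
          apply hij
          have : j * i⁻¹ = 1 := Subtype.ext h
          exact (mul_inv_eq_one.1 this).symm) t
        refine ⟨_, ⟨_, hMP f hf (i⁻¹ : P), rfl⟩, ?_, ?_⟩
        · simpa [res] using h1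
        · simpa [res] using h2
    apply le_antisymm hMN
    intro f hf
    have : res f ∈ M.map res := by rw [htop]; trivial
    obtain ⟨f', hf', he⟩ := this
    have : f = f' := by
      funext h
      obtain ⟨q, v, hv, rfl⟩ := hdec h
      have h3 : f' v = f v := congrFun he ⟨v, hv⟩
      rw [hMq f' hf', hf v q, h3]
    rw [this]; exact hf'

/-- Under the Hypothesis, in the twisted wreath product `G = T twr_φ P = N ⋊ P`
(with `N` and `P` identified with subgroups of `G`), the subgroup `N̂P` generated by
`N̂ = { f_t : t ∈ T }` and `P` is the unique subgroup lying strictly between `P` and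
`G`: every subgroup `H` with `P ≤ H ≤ G` equals `P`, `N̂P` or `G`. -/
theorem stmt_9
    -- The Hypothesis --
    (p : ℕ) (hp : p.Prime)
    {P : Type*} [Group P] [Fintype P]
    -- `V` and `Q` are identified with subgroups of `P = V ⋊ Q`:
    (V Q : Subgroup P) (hVnorm : V.Normal)
    -- every element of `P` is uniquely a product `v * q` with `v ∈ V`, `q ∈ Q`:
    (hcompl : Subgroup.IsComplement' V Q)
    -- `V` is a (finite) vector space over `𝔽_p`, i.e. elementary abelian of exponent `p`:
    (hVab : ∀ a ∈ V, ∀ b ∈ V, a * b = b * a) (hVp : ∀ a ∈ V, a ^ p = 1)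
    -- of order `k = |V| ≥ 2`:
    (hVcard : 2 ≤ Nat.card V)
    -- the (conjugation) action of `Q` on `V` is faithful:
    (hfaith : ∀ q ∈ Q, (∀ v ∈ V, q * v * q⁻¹ = v) → q = 1)
    -- and transitive on the nonzero vectors of `V`:
    (htrans : ∀ v ∈ V, ∀ w ∈ V, v ≠ 1 → w ≠ 1 → ∃ q ∈ Q, q * v * q⁻¹ = w)
    -- `T` is a finite nonabelian simple group:
    {T : Type*} [Group T] [Finite T] [IsSimpleGroup T]
    (hTna : ∃ a b : T, a * b ≠ b * a)
    -- and `φ : Q → Aut T` is a homomorphism whose image contains `Inn T`: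
    (φ : Q →* MulAut T) (hφ : ∀ t : T, MulAut.conj t ∈ φ.range)
    -- `φ̂`, the homomorphism `P → Aut T` restricting to `φ` on `Q`:
    (φhat : P →* MulAut T) (hext : ∀ q : Q, φhat ↑q = φ q) :
    ∃ NhatP : Subgroup (twN Q φ ⋊[twAct Q φ] P),
      -- `NhatP` is the subgroup generated by `N̂ = {f_t : t ∈ T}` and `P`:
      NhatP = Subgroup.closure {x : twN Q φ ⋊[twAct Q φ] P |
          (∃ t : T, ∀ h : P, (x.left : P → T) h = φhat h t) ∧ x.right = 1} ⊔
        SemidirectProduct.inr.range ∧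
      -- it lies strictly between `P` and `G`:
      SemidirectProduct.inr.range < NhatP ∧ NhatP < ⊤ ∧
      -- and it is the only subgroup that does:
      (∀ H : Subgroup (twN Q φ ⋊[twAct Q φ] P), SemidirectProduct.inr.range ≤ H →
          H = SemidirectProduct.inr.range ∨ H = NhatP ∨ H = ⊤) := by
  classical
  have hmem : ∀ x, x ∈ Subgroup.closure {x : twN Q φ ⋊[twAct Q φ] P |
          (∃ t : T, ∀ h : P, (x.left : P → T) h = φhat h t) ∧ x.right = 1} ⊔
        SemidirectProduct.inr.range ↔ ∃ t : T, ∀ h : P, (x.left : P → T) h = φhat h t := by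
    let K : Subgroup (twN Q φ ⋊[twAct Q φ] P) :=
      { carrier := {x | ∃ t : T, ∀ h : P, (x.left : P → T) h = φhat h t}
        one_mem' := ⟨1, fun h => by simp⟩
        mul_mem' := by
          rintro x y ⟨t, ht⟩ ⟨s, hs⟩
          refine ⟨t * φhat x.right s, fun h => ?_⟩
          change (x.left : P → T) h * (y.left : P → T) (h * x.right) = _
          rw [ht, hs, map_mul, map_mul]; rfl
        inv_mem' := by
          rintro x ⟨t, ht⟩
          refine ⟨φhat x.right⁻¹ t⁻¹, fun h => ?_⟩
          change ((x.left : P → T) (h * x.right⁻¹))⁻¹ = _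
          rw [ht, ← map_inv, map_mul]; rfl }
    intro x
    constructor
    · intro hx
      have hle : Subgroup.closure {x : twN Q φ ⋊[twAct Q φ] P |
          (∃ t : T, ∀ h : P, (x.left : P → T) h = φhat h t) ∧ x.right = 1} ⊔
        SemidirectProduct.inr.range ≤ K := by
        apply sup_le
        · rw [Subgroup.closure_le]
          exact fun y hy => hy.1
        · rintro _ ⟨g, rfl⟩
          exact ⟨1, fun h => by simp⟩
      exact hle hx
    · intro hx
      rw [← SemidirectProduct.inl_left_mul_inr_right x]
      apply Subgroup.mul_mem
      · apply Subgroup.mem_sup_left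
        apply Subgroup.subset_closure
        exact ⟨by simpa using hx, by simp⟩
      · exact Subgroup.mem_sup_right ⟨_, rfl⟩
  obtain ⟨t0, ht0⟩ := exists_ne (1 : T)
  refine ⟨_, rfl, ?_, ?_, ?_⟩
  · refine lt_of_le_of_ne le_sup_right ?_
    intro heq
    let f : twN Q φ := ⟨fun h => φhat h t0, fun h q => by
      simp [hext]⟩
    have h1 : (SemidirectProduct.inl f : twN Q φ ⋊[twAct Q φ] P) ∈
        (SemidirectProduct.inr.range : Subgroup (twN Q φ ⋊[twAct Q φ] P)) := by
      rw [heq, hmem]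
      exact ⟨t0, fun h => by simp [f]⟩
    obtain ⟨g, hg⟩ := h1
    have h2 : (1 : twN Q φ) = f := by simpa using congrArg SemidirectProduct.left hg
    have h3 : (1 : T) = φhat 1 t0 := congrFun (congrArg Subtype.val h2) 1
    apply ht0
    simpa using h3.symm
  · rw [lt_top_iff_ne_top]
    intro heq
    let f : twN Q φ := ⟨fun h => if h ∈ Q then φhat h t0 else 1, fun h q => by
      have : (q : P) * h ∈ Q ↔ h ∈ Q := Subgroup.mul_mem_cancel_left Q q.2
      by_cases hh : h ∈ Q <;> simp [this, hh, hext]⟩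
    have h1 : ∃ t : T, ∀ h : P,
        ((SemidirectProduct.inl f : twN Q φ ⋊[twAct Q φ] P).left : P → T) h = φhat h t := by
      rw [← hmem, heq]; trivial
    obtain ⟨t, ht⟩ := h1
    have ht1 : ∀ h : P, (if h ∈ Q then φhat h t0 else 1) = φhat h t := ht
    have e1 : t0 = t := by simpa [Q.one_mem] using ht1 1
    have : Nontrivial V := (Finite.one_lt_card_iff_nontrivial).1 (by omega)
    obtain ⟨v, hv⟩ := exists_ne (1 : V)
    have hvQ : (v : P) ∉ Q := by
      intro hq
      have : (v : P) ∈ V ⊓ Q := ⟨v.2, hq⟩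
      rw [hcompl.disjoint.eq_bot] at this
      exact hv (Subtype.ext (by simpa using this))
    have e2 := ht1 v
    rw [if_neg hvQ] at e2
    have : t = 1 := by simpa using e2.symm
    exact ht0 (e1.trans this)
  · intro H hH
    have hHmem : ∀ x : twN Q φ ⋊[twAct Q φ] P, x ∈ H ↔
        (x.left : P → T) ∈ (H.comap SemidirectProduct.inl).map (twN Q φ).subtype := by
      intro x
      have hr : (SemidirectProduct.inr x.right : twN Q φ ⋊[twAct Q φ] P) ∈ H := hH ⟨_, rfl⟩
      have : x ∈ H ↔ SemidirectProduct.inl x.left ∈ H := by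
        conv_lhs => rw [← SemidirectProduct.inl_left_mul_inr_right x]
        exact Subgroup.mul_mem_cancel_right H hr
      rw [this]
      constructor
      · intro h
        exact ⟨x.left, h, rfl⟩
      · rintro ⟨y, hy, hyx⟩
        have : y = x.left := Subtype.ext hyx
        rw [← this]; exact hy
    rcases tw_invariant V Q hVnorm hcompl hVab htrans hTna φ hφ φhat hext
      ((H.comap SemidirectProduct.inl).map (twN Q φ).subtype)
      (by rintro _ ⟨y, _, rfl⟩; exact y.2)
      (by
        rintro _ ⟨y, hy, rfl⟩ g
        refine ⟨twAct Q φ g y, ?_, rfl⟩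
        have hr : (SemidirectProduct.inr g : twN Q φ ⋊[twAct Q φ] P) ∈ H := hH ⟨_, rfl⟩
        have hy' : (SemidirectProduct.inl y : twN Q φ ⋊[twAct Q φ] P) ∈ H := hy
        change SemidirectProduct.inl (twAct Q φ g y) ∈ H
        rw [SemidirectProduct.inl_aut, map_inv]
        exact H.mul_mem (H.mul_mem hr hy') (H.inv_mem hr)) with h | h | h
    · left
      refine le_antisymm ?_ hH
      intro x hx
      rw [hHmem, h, Subgroup.mem_bot] at hx
      have hx1 : x.left = 1 := Subtype.ext hx
      refine ⟨x.right, ?_⟩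
      conv_rhs => rw [← SemidirectProduct.inl_left_mul_inr_right x, hx1]
      simp
    · right; left
      ext x
      rw [hHmem, h, hmem]
    · right; right
      rw [eq_top_iff]
      intro x _
      rw [hHmem, h]
      exact x.left.2
end

section
/- Under the Hypothesis, let R be a nontrivial subgroup of N_k = { f ∈ N : f(q) = 1 for all q ∈ Q } that is invariant under the action of Q and for which there is a group isomorphism R → V intertwining the Q-action on R with the linear action of Q on V. Then the normal subgroup N of the twisted wreath product G = N ⋊ P is intransitive on the coset space Δ2 = {RQx : x ∈ G}, having exactly |V| orbits; in particular the (faithful) action of G on Δ2 is not quasiprimitive. -/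
/-- Under the Hypothesis, let `R` be a nontrivial subgroup of
`N_k = { f ∈ N : f(q) = 1 ∀ q ∈ Q }` invariant under the action of `Q` and
isomorphic to `V` as a `Q`-group.  Then the normal subgroup `N` of the twisted
wreath product `G = N ⋊ P` is intransitive on the coset space `Δ2 = G/RQ`, having
exactly `|V|` orbits; in particular the (faithful) action of `G` on `Δ2` is not
quasiprimitive. -/
theorem stmt_14
    -- The Hypothesis --
    (p : ℕ) (hp : p.Prime)
    {P : Type*} [Group P] [Fintype P]
    -- `V` and `Q` are identified with subgroups of `P = V ⋊ Q`:
    (V Q : Subgroup P) (hVnorm : V.Normal)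
    -- every element of `P` is uniquely a product `v * q` with `v ∈ V`, `q ∈ Q`:
    (hcompl : Subgroup.IsComplement' V Q)
    -- `V` is a (finite) vector space over `𝔽_p`, i.e. elementary abelian of exponent `p`:
    (hVab : ∀ a ∈ V, ∀ b ∈ V, a * b = b * a) (hVp : ∀ a ∈ V, a ^ p = 1)
    -- of order `k = |V| ≥ 2`:
    (hVcard : 2 ≤ Nat.card V)
    -- the (conjugation) action of `Q` on `V` is faithful:
    (hfaith : ∀ q ∈ Q, (∀ v ∈ V, q * v * q⁻¹ = v) → q = 1)
    -- and transitive on the nonzero vectors of `V`: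
    (htrans : ∀ v ∈ V, ∀ w ∈ V, v ≠ 1 → w ≠ 1 → ∃ q ∈ Q, q * v * q⁻¹ = w)
    -- `T` is a finite nonabelian simple group:
    {T : Type*} [Group T] [Finite T] [IsSimpleGroup T]
    (hTna : ∃ a b : T, a * b ≠ b * a)
    -- and `φ : Q → Aut T` is a homomorphism whose image contains `Inn T`:
    (φ : Q →* MulAut T) (hφ : ∀ t : T, MulAut.conj t ∈ φ.range)
    -- `R` is a nontrivial subgroup of `N_k = { f ∈ N : f(q) = 1 ∀ q ∈ Q }` ...
    (R : Subgroup (P → T)) (hRN : R ≤ twN Q φ) (hRk : ∀ f ∈ R, ∀ q ∈ Q, f q = 1)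
    (hRnt : R ≠ ⊥)
    -- ... invariant under the action of `Q` on `N` ...
    (hRinv : ∀ q : Q, ∀ f ∈ R, (fun h : P => f (h * ↑q)) ∈ R)
    -- ... and isomorphic to `V` as a `Q`-group:
    (hRV : ∃ e : R ≃* V, ∀ (f : P → T) (hf : f ∈ R) (q : Q)
        (hfq : (fun h : P => f (h * ↑q)) ∈ R),
        (e ⟨fun h : P => f (h * ↑q), hfq⟩ : P) = ↑q * (e ⟨f, hf⟩ : P) * (↑q)⁻¹) :
    ∀ RQ : Subgroup (twN Q φ ⋊[twAct Q φ] P),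
      -- `RQ` is the subgroup of `G` generated by `R` and `Q`:
      RQ = Subgroup.closure {y : twN Q φ ⋊[twAct Q φ] P |
          ((y.left : P → T) ∈ R ∧ y.right = 1) ∨ (y.left = 1 ∧ y.right ∈ Q)} →
      -- the action of `G` on `Δ2 = G/RQ` is faithful,
      ((∀ g : twN Q φ ⋊[twAct Q φ] P,
          (∀ b : (twN Q φ ⋊[twAct Q φ] P) ⧸ RQ, g • b = b) → g = 1) ∧
      -- `N` is intransitive on `Δ2` ...
      ¬ (∀ b b' : (twN Q φ ⋊[twAct Q φ] P) ⧸ RQ,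
          ∃ n ∈ (SemidirectProduct.inl : twN Q φ →* twN Q φ ⋊[twAct Q φ] P).range,
            n • b = b') ∧
      -- ... having exactly `|V|` orbits on `Δ2`,
      Nat.card (Quotient (MulAction.orbitRel
          (SemidirectProduct.inl : twN Q φ →* twN Q φ ⋊[twAct Q φ] P).range
          ((twN Q φ ⋊[twAct Q φ] P) ⧸ RQ))) = Nat.card V ∧
      -- so the action of `G` on `Δ2` is not quasiprimitive:
      ¬ (∀ M : Subgroup (twN Q φ ⋊[twAct Q φ] P), M.Normal → M ≠ ⊥ →
          ∀ b b' : (twN Q φ ⋊[twAct Q φ] P) ⧸ RQ, ∃ m ∈ M, m • b = b')) := by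
  intro RQ hRQ
  have hmem : ∀ y : twN Q φ ⋊[twAct Q φ] P, y ∈ RQ ↔ ((y.left : P → T) ∈ R ∧ y.right ∈ Q) := by
    intro y
    constructor
    · intro hy
      rw [hRQ] at hy
      induction hy using Subgroup.closure_induction with
      | mem x hx =>
        rcases hx with ⟨h1, h2⟩ | ⟨h1, h2⟩
        · exact ⟨h1, h2 ▸ Q.one_mem⟩
        · refine ⟨?_, h2⟩
          rw [h1]
          exact R.one_mem
      | one => exact ⟨R.one_mem, Q.one_mem⟩
      | mul x z _ _ hx hz =>
        refine ⟨?_, Q.mul_mem hx.2 hz.2⟩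
        exact R.mul_mem hx.1 (hRinv ⟨x.right, hx.2⟩ _ hz.1)
      | inv x _ hx =>
        refine ⟨?_, Q.inv_mem hx.2⟩
        exact hRinv ⟨x.right⁻¹, Q.inv_mem hx.2⟩ _ (R.inv_mem hx.1)
    · rintro ⟨h1, h2⟩
      rw [← SemidirectProduct.inl_left_mul_inr_right y, hRQ]
      refine Subgroup.mul_mem _ (Subgroup.subset_closure (Or.inl ⟨?_, ?_⟩))
        (Subgroup.subset_closure (Or.inr ⟨?_, ?_⟩))
      · simpa using h1
      · simp
      · simp
      · simpa using h2
  have hfaithful : ∀ g : twN Q φ ⋊[twAct Q φ] P,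
      (∀ b : (twN Q φ ⋊[twAct Q φ] P) ⧸ RQ, g • b = b) → g = 1 := by
    intro g hg
    have hc : ∀ x : P, SemidirectProduct.inr x * g * (SemidirectProduct.inr x)⁻¹ ∈ RQ := by
      intro x
      have h := hg ((SemidirectProduct.inr x)⁻¹ : twN Q φ ⋊[twAct Q φ] P)
      have h2 := QuotientGroup.eq.1 h.symm
      simpa [mul_assoc] using h2
    have hr : g.right = 1 := by
      have h1 := ((hmem _).1 (hc 1)).2
      have hq : g.right ∈ Q := by simpa using h1
      apply hfaith _ hq
      intro v hv
      have h2 : v * g.right * v⁻¹ ∈ Q := by simpa using ((hmem _).1 (hc v)).2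
      have h3 : v * g.right * v⁻¹ * g.right⁻¹ ∈ Q := Q.mul_mem h2 (Q.inv_mem hq)
      have h4 : v * g.right * v⁻¹ * g.right⁻¹ ∈ V := by
        have := V.mul_mem hv (hVnorm.conj_mem _ (V.inv_mem hv) g.right)
        simpa [mul_assoc] using this
      have h5 : v * g.right * v⁻¹ * g.right⁻¹ = 1 :=
        Subgroup.disjoint_def.1 hcompl.disjoint h4 h3
      have h6 : v * g.right = g.right * v := by
        have := mul_inv_eq_one.1 h5
        exact mul_inv_eq_iff_eq_mul.1 this
      rw [← h6]; simp
    have hl : g.left = 1 := by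
      apply Subtype.ext
      funext x
      have h1 := hRk _ ((hmem _).1 (hc x)).1 1 Q.one_mem
      have e : SemidirectProduct.inr x * g * (SemidirectProduct.inr x)⁻¹
          = SemidirectProduct.inl (twAct Q φ x g.left) := by
        ext1 <;> simp [hr]
      rw [e, SemidirectProduct.left_inl] at h1
      have h2 : (g.left : P → T) (1 * x) = 1 := h1
      rw [one_mul] at h2
      exact h2
    exact SemidirectProduct.ext hl hr
  have hinl : ∀ g : twN Q φ ⋊[twAct Q φ] P, g.right = 1 →
      g ∈ (SemidirectProduct.inl : twN Q φ →* twN Q φ ⋊[twAct Q φ] P).range := by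
    intro g hg
    exact ⟨g.left, SemidirectProduct.ext rfl hg.symm⟩
  have hcardeq : Nat.card (Quotient (MulAction.orbitRel
          (SemidirectProduct.inl : twN Q φ →* twN Q φ ⋊[twAct Q φ] P).range
          ((twN Q φ ⋊[twAct Q φ] P) ⧸ RQ))) = Nat.card V := by
    rw [← hcompl.index_eq_card]
    let F : (twN Q φ ⋊[twAct Q φ] P) ⧸ RQ → P ⧸ Q :=
      Quotient.lift (fun g => (g.right : P ⧸ Q)) (by
        intro a b hab
        apply QuotientGroup.eq.2
        simpa using ((hmem _).1 (QuotientGroup.leftRel_apply.1 hab)).2)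
    let F2 : Quotient (MulAction.orbitRel
          (SemidirectProduct.inl : twN Q φ →* twN Q φ ⋊[twAct Q φ] P).range
          ((twN Q φ ⋊[twAct Q φ] P) ⧸ RQ)) → P ⧸ Q :=
      Quotient.lift F (by
        intro a b hab
        obtain ⟨⟨_, n, rfl⟩, rfl⟩ := MulAction.orbitRel_apply.1 hab
        induction b using QuotientGroup.induction_on with
        | H z =>
          change ((SemidirectProduct.inl n * z : twN Q φ ⋊[twAct Q φ] P).right : P ⧸ Q)
            = (z.right : P ⧸ Q)
          simp)
    refine Nat.card_eq_of_bijective F2 ⟨?_, ?_⟩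
    · intro a b hab
      induction a using Quotient.inductionOn with | h a => ?_
      induction b using Quotient.inductionOn with | h b => ?_
      induction a using QuotientGroup.induction_on with | H x => ?_
      induction b using QuotientGroup.induction_on with | H y => ?_
      have h1 : (x.right : P ⧸ Q) = (y.right : P ⧸ Q) := hab
      have h2 := QuotientGroup.eq.1 h1.symm
      apply Quotient.sound
      apply MulAction.orbitRel_apply.2
      refine ⟨⟨x * (SemidirectProduct.inr (y.right⁻¹ * x.right))⁻¹ * y⁻¹, hinl _ (by simp)⟩, ?_⟩
      change ((x * (SemidirectProduct.inr (y.right⁻¹ * x.right))⁻¹ * y⁻¹ * y :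
        twN Q φ ⋊[twAct Q φ] P) : (twN Q φ ⋊[twAct Q φ] P) ⧸ RQ) = _
      apply QuotientGroup.eq.2
      rw [hmem]
      rw [inv_mul_cancel_right, mul_inv_rev, inv_inv, inv_mul_cancel_right]
      refine ⟨?_, ?_⟩
      · rw [SemidirectProduct.left_inr]; exact R.one_mem
      · rw [SemidirectProduct.right_inr]; exact h2
    · intro z
      induction z using QuotientGroup.induction_on with | H x => ?_
      exact ⟨Quotient.mk _ ((SemidirectProduct.inr x : twN Q φ ⋊[twAct Q φ] P) :
        (twN Q φ ⋊[twAct Q φ] P) ⧸ RQ), rfl⟩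
  have hintr : ¬ (∀ b b' : (twN Q φ ⋊[twAct Q φ] P) ⧸ RQ,
          ∃ n ∈ (SemidirectProduct.inl : twN Q φ →* twN Q φ ⋊[twAct Q φ] P).range,
            n • b = b') := by
    intro h
    have hsub : Subsingleton (Quotient (MulAction.orbitRel
          (SemidirectProduct.inl : twN Q φ →* twN Q φ ⋊[twAct Q φ] P).range
          ((twN Q φ ⋊[twAct Q φ] P) ⧸ RQ))) := by
      refine ⟨fun a b => ?_⟩
      induction a using Quotient.inductionOn with | h a => ?_
      induction b using Quotient.inductionOn with | h b => ?_
      apply Quotient.sound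
      apply MulAction.orbitRel_apply.2
      obtain ⟨n, hn, e⟩ := h b a
      exact ⟨⟨n, hn⟩, e⟩
    have := Finite.card_le_one_iff_subsingleton.2 hsub
    omega
  refine ⟨hfaithful, hintr, hcardeq, ?_⟩
  intro h
  apply hintr
  apply h
  · rw [SemidirectProduct.range_inl_eq_ker_rightHom]
    infer_instance
  · intro hb
    apply hRnt
    rw [eq_bot_iff]
    intro f hf
    have h1 : (SemidirectProduct.inl (⟨f, hRN hf⟩ : twN Q φ) : twN Q φ ⋊[twAct Q φ] P) ∈
        (SemidirectProduct.inl : twN Q φ →* twN Q φ ⋊[twAct Q φ] P).range := ⟨_, rfl⟩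
    rw [hb, Subgroup.mem_bot] at h1
    have h2 := congrArg (fun g => ((SemidirectProduct.left g : twN Q φ) : P → T)) h1
    exact Subgroup.mem_bot.2 h2
end
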